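/- arXiv:1908.09594 — 9 statements merged into one kernel-verified Lean document; each statement's English description precedes it below -/
import Mathlib

section
/- Let m ≥ 1 and 0 ≤ ε ≤ 1. Splitting the M-ary erasure channel (M = 2^m) into m binary erasure channels conserves capacity but boosts the cutoff rate: C(MEC(2^m, ε)) = m · C(BEC(ε)), while R₀(MEC(2^m, ε)) ≤ m · R₀(BEC(ε)); moreover, if m ≥ 2 and 0 < ε < 1 the latter inequality is strict. Equivalently, (1 + ε)^m ≤ 1 + (2^m − 1)·ε, with strict inequality when m ≥ 2 and 0 < ε < 1. -/
open scoped BigOperators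

/-- Symmetric capacity of a memoryless channel with finite input alphabet `X`
and finite output alphabet `Y` (uniform input distribution).  Terms with
`W x y = 0` automatically contribute `0`. -/
noncomputable def capacityM {X Y : Type*} [Fintype X] [Fintype Y] (W : X → Y → ℝ) : ℝ :=
  ∑ y : Y, ∑ x : X,
    (1 / (Fintype.card X : ℝ)) * W x y *
      Real.logb 2 (W x y / ((1 / (Fintype.card X : ℝ)) * ∑ x' : X, W x' y))

/-- Symmetric cutoff rate of a memoryless channel (uniform input distribution). -/
noncomputable def cutoffRateM {X Y : Type*} [Fintype X] [Fintype Y] (W : X → Y → ℝ) : ℝ :=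
  - Real.logb 2 (∑ y : Y, ((1 / (Fintype.card X : ℝ)) * ∑ x : X, Real.sqrt (W x y)) ^ 2)

/-- The `M`-ary erasure channel with erasure probability `ε`.  The binary
erasure channel `BEC(ε)` is the case `M = 2`. -/
def MEC (M : ℕ) (ε : ℝ) : Fin M → Option (Fin M) → ℝ := fun x y =>
  match y with
  | some x' => if x' = x then 1 - ε else 0
  | none => ε

lemma capacityM_MEC (M : ℕ) (hM : M ≠ 0) (ε : ℝ) :
    capacityM (MEC M ε) = (1 - ε) * Real.logb 2 M := by
  have hM' : (M : ℝ) ≠ 0 := Nat.cast_ne_zero.mpr hM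
  have erased : ∑ x : Fin M, 1 / (M : ℝ) * ε *
      Real.logb 2 (ε / (1 / (M : ℝ) * ∑ _x' : Fin M, ε)) = 0 := by
    rcases eq_or_ne ε 0 with rfl | hε
    · simp
    · have : ε / (1 / (M : ℝ) * ∑ _x' : Fin M, ε) = 1 := by
        simp only [Finset.sum_const, Finset.card_univ, Fintype.card_fin, nsmul_eq_mul]
        field_simp
      rw [this, Real.logb_one, mul_zero, Finset.sum_const_zero]
  have received (y : Fin M) : ∑ x : Fin M, 1 / (M : ℝ) * (if y = x then 1 - ε else 0) *
      Real.logb 2 ((if y = x then 1 - ε else 0) /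
        (1 / (M : ℝ) * ∑ x' : Fin M, if y = x' then 1 - ε else 0)) =
      1 / (M : ℝ) * ((1 - ε) * Real.logb 2 M) := by
    rw [Finset.sum_eq_single y (fun x _ hx => by simp [hx.symm]) (by simp)]
    simp only [Finset.sum_ite_eq, Finset.mem_univ, if_true]
    rcases eq_or_ne (1 - ε) 0 with hε | hε
    · simp [hε]
    · have : (1 - ε) / (1 / (M : ℝ) * (1 - ε)) = M := by field_simp
      rw [this, mul_assoc]
  simp only [capacityM, MEC, Fintype.sum_option, Fintype.card_fin]
  rw [erased, Finset.sum_congr rfl fun y _ => received y]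
  simp only [Finset.sum_const, Finset.card_univ, Fintype.card_fin, nsmul_eq_mul]
  field_simp
  ring

lemma cutoffRateM_MEC (M : ℕ) (hM : M ≠ 0) (ε : ℝ) (hε0 : 0 ≤ ε) (hε1 : ε ≤ 1) :
    cutoffRateM (MEC M ε) = Real.logb 2 M - Real.logb 2 (1 + ((M : ℝ) - 1) * ε) := by
  have hM' : (M : ℝ) ≠ 0 := Nat.cast_ne_zero.mpr hM
  have hM1 : (1 : ℝ) ≤ M := Nat.one_le_cast.mpr (Nat.one_le_iff_ne_zero.mpr hM)
  have hpos : 1 + ((M : ℝ) - 1) * ε ≠ 0 := by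
    have := mul_nonneg (sub_nonneg.mpr hM1) hε0
    positivity
  have hsum : ∑ y : Option (Fin M),
      ((1 / (Fintype.card (Fin M) : ℝ)) * ∑ x : Fin M, Real.sqrt (MEC M ε x y)) ^ 2 =
      (1 + ((M : ℝ) - 1) * ε) / M := by
    simp only [MEC, Fintype.sum_option, Fintype.card_fin, apply_ite Real.sqrt, Real.sqrt_zero,
      Finset.sum_ite_eq, Finset.mem_univ, if_true, Finset.sum_const, Finset.card_univ,
      nsmul_eq_mul, mul_pow, Real.sq_sqrt hε0, Real.sq_sqrt (sub_nonneg.mpr hε1)]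
    field_simp
    ring
  rw [cutoffRateM, hsum, Real.logb_div hpos hM']
  ring

lemma one_add_pow_lt_chord (m : ℕ) (hm : 2 ≤ m) (ε : ℝ) (hε0 : 0 < ε) (hε1 : ε < 1) :
    (1 + ε) ^ m < 1 + ((2 : ℝ) ^ m - 1) * ε := by
  have hε : 0 < ε * (1 - ε) := mul_pos hε0 (sub_pos.mpr hε1)
  induction m, hm using Nat.le_induction with
  | base => nlinarith
  | succ k hk ih =>
    have h2 : (0 : ℝ) < 2 ^ k - 1 := sub_pos.mpr (one_lt_pow₀ one_lt_two (by lia))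
    have := mul_lt_mul_of_pos_right ih (by linarith : (0 : ℝ) < 1 + ε)
    rw [pow_succ, pow_succ]
    nlinarith [mul_pos h2 hε]

lemma one_add_pow_le_chord (m : ℕ) (hm : 1 ≤ m) (ε : ℝ) (hε0 : 0 ≤ ε) (hε1 : ε ≤ 1) :
    (1 + ε) ^ m ≤ 1 + ((2 : ℝ) ^ m - 1) * ε := by
  rcases hε0.eq_or_lt with rfl | h0
  · simp
  rcases hε1.eq_or_lt with rfl | h1
  · norm_num
  rcases hm.eq_or_lt with rfl | hm
  · norm_num
  exact (one_add_pow_lt_chord m hm ε h0 h1).le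

theorem stmt2 (m : ℕ) (hm : 1 ≤ m) (ε : ℝ) (hε0 : 0 ≤ ε) (hε1 : ε ≤ 1) :
    capacityM (MEC (2 ^ m) ε) = (m : ℝ) * capacityM (MEC 2 ε) ∧
    cutoffRateM (MEC (2 ^ m) ε) ≤ (m : ℝ) * cutoffRateM (MEC 2 ε) ∧
    (2 ≤ m → 0 < ε → ε < 1 →
      cutoffRateM (MEC (2 ^ m) ε) < (m : ℝ) * cutoffRateM (MEC 2 ε)) ∧
    (1 + ε) ^ m ≤ 1 + ((2 : ℝ) ^ m - 1) * ε ∧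
    (2 ≤ m → 0 < ε → ε < 1 → (1 + ε) ^ m < 1 + ((2 : ℝ) ^ m - 1) * ε) := by
  have hlog : Real.logb 2 ((2 ^ m : ℕ) : ℝ) = m := by
    rw [Nat.cast_pow, Nat.cast_ofNat, Real.logb_pow, Real.logb_self_eq_one one_lt_two, mul_one]
  have hpow : (0 : ℝ) < (1 + ε) ^ m := by positivity
  have hMEC : cutoffRateM (MEC (2 ^ m) ε) =
      m - Real.logb 2 (1 + ((2 : ℝ) ^ m - 1) * ε) := by
    rw [cutoffRateM_MEC _ (by positivity) ε hε0 hε1, hlog, Nat.cast_pow, Nat.cast_ofNat]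
  have hBEC : (m : ℝ) * cutoffRateM (MEC 2 ε) = m - Real.logb 2 ((1 + ε) ^ m) := by
    rw [cutoffRateM_MEC 2 two_ne_zero ε hε0 hε1, Nat.cast_ofNat,
      Real.logb_self_eq_one one_lt_two, Real.logb_pow,
      show (1 : ℝ) + (2 - 1) * ε = 1 + ε by ring]
    ring
  have hle := one_add_pow_le_chord m hm ε hε0 hε1
  refine ⟨?_, ?_, fun h2 h0 h1 => ?_, hle, fun h2 h0 h1 => one_add_pow_lt_chord m h2 ε h0 h1⟩
  · rw [capacityM_MEC _ (by positivity), capacityM_MEC 2 two_ne_zero, hlog, Nat.cast_ofNat,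
      Real.logb_self_eq_one one_lt_two]
    ring
  · rw [hMEC, hBEC]
    exact sub_le_sub_left (Real.logb_le_logb_of_le one_lt_two hpow hle) _
  · rw [hMEC, hBEC]
    exact sub_lt_sub_left
      (Real.logb_lt_logb one_lt_two hpow (one_add_pow_lt_chord m h2 ε h0 h1)) _
end

section
/- For every binary-input memoryless channel W with finite output alphabet, the symmetric cutoff rate is at most the symmetric capacity: R₀(W) ≤ C(W), i.e., 1 − log₂(1 + Z(W)) ≤ C(W). -/
open scoped BigOperators

/-- Symmetric capacity of a binary-input memoryless channel with finite output
alphabet `Y`.  Terms with `W x y = 0` automatically contribute `0`. -/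
noncomputable def capacity {Y : Type*} [Fintype Y] (W : ZMod 2 → Y → ℝ) : ℝ :=
  ∑ y : Y, ∑ x : ZMod 2,
    (1 / 2) * W x y * Real.logb 2 (W x y / ((1 / 2) * W 0 y + (1 / 2) * W 1 y))

/-- Bhattacharyya parameter of a BMC. -/
noncomputable def bhattacharyya {Y : Type*} [Fintype Y] (W : ZMod 2 → Y → ℝ) : ℝ :=
  ∑ y : Y, Real.sqrt (W 0 y * W 1 y)

/-- Symmetric cutoff rate of a BMC: `R₀(W) = 1 − log₂(1 + Z(W))`. -/
noncomputable def cutoffRate {Y : Type*} [Fintype Y] (W : ZMod 2 → Y → ℝ) : ℝ :=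
  1 - Real.logb 2 (1 + bhattacharyya W)

/-- The tangent-line bound behind the Jensen inequality for the cutoff rate. -/
lemma sq_mul_log_div_add_log_ge {u q s S : ℝ} (hu : 0 ≤ u) (hq : 0 < q) (hs : 0 < s)
    (hS : 0 < S) :
    u ^ 2 * (3 - s ^ 2 / (q * S)) - 2 * (q * u / s) ≤
      u ^ 2 * (Real.log (u ^ 2 / q) + Real.log S) := by
  rcases hu.eq_or_lt with rfl | hu
  · simp
  have h₁ := Real.log_le_sub_one_of_pos (show 0 < q / (u * s) by positivity)
  have h₂ := Real.log_le_sub_one_of_pos (show 0 < s ^ 2 / (q * S) by positivity)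
  rw [Real.log_div (by positivity) (by positivity), Real.log_mul (by positivity) (by positivity)]
    at h₁
  rw [Real.log_div (by positivity) (by positivity), Real.log_mul (by positivity) (by positivity),
    Real.log_pow] at h₂
  rw [Real.log_div (by positivity) (by positivity), Real.log_pow]
  push_cast at h₂ ⊢
  have h₃ : 3 - s ^ 2 / (q * S) - 2 * (q / (u * s)) ≤
      2 * Real.log u - Real.log q + Real.log S := by linarith
  calc _ = u ^ 2 * (3 - s ^ 2 / (q * S) - 2 * (q / (u * s))) := by field_simp
    _ ≤ _ := by gcongr

/-- The contribution of a single output letter with transition probabilities `a` and `b`. -/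
lemma half_mul_log_div_mean_add_ge {a b S : ℝ} (ha : 0 ≤ a) (hb : 0 ≤ b) (hS : 0 < S) :
    (a + b) / 2 - ((a + b) / 2 + √(a * b)) / 2 / S ≤
      1 / 2 * a * Real.log (a / (1 / 2 * a + 1 / 2 * b)) +
        1 / 2 * b * Real.log (b / (1 / 2 * a + 1 / 2 * b)) + (a + b) / 2 * Real.log S := by
  obtain ⟨u, hu, rfl⟩ : ∃ u : ℝ, 0 ≤ u ∧ u ^ 2 = a := ⟨√a, Real.sqrt_nonneg _, Real.sq_sqrt ha⟩
  obtain ⟨v, hv, rfl⟩ : ∃ v : ℝ, 0 ≤ v ∧ v ^ 2 = b := ⟨√b, Real.sqrt_nonneg _, Real.sq_sqrt hb⟩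
  rw [← mul_pow, Real.sqrt_sq (mul_nonneg hu hv)]
  rcases (add_nonneg hu hv).eq_or_lt with h | h
  · obtain rfl : u = 0 := by linarith
    obtain rfl : v = 0 := by linarith
    simp
  have hq : 0 < 1 / 2 * u ^ 2 + 1 / 2 * v ^ 2 := by
    nlinarith [sq_nonneg (u - v), pow_pos h 2]
  have h₁ := sq_mul_log_div_add_log_ge hu hq (half_pos h) hS
  have h₂ := sq_mul_log_div_add_log_ge hv hq (half_pos h) hS
  have h₃ : (u ^ 2 + v ^ 2) / 2 - ((u ^ 2 + v ^ 2) / 2 + u * v) / 2 / S =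
      1 / 2 * (u ^ 2 * (3 - ((u + v) / 2) ^ 2 / ((1 / 2 * u ^ 2 + 1 / 2 * v ^ 2) * S)) -
        2 * ((1 / 2 * u ^ 2 + 1 / 2 * v ^ 2) * u / ((u + v) / 2))) +
      1 / 2 * (v ^ 2 * (3 - ((u + v) / 2) ^ 2 / ((1 / 2 * u ^ 2 + 1 / 2 * v ^ 2) * S)) -
        2 * ((1 / 2 * u ^ 2 + 1 / 2 * v ^ 2) * v / ((u + v) / 2))) := by
    have hq' : u ^ 2 + v ^ 2 ≠ 0 := by linarith
    have e : 1 / 2 * u ^ 2 + 1 / 2 * v ^ 2 = (u ^ 2 + v ^ 2) / 2 := by ring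
    rw [e]
    field_simp
    ring
  linarith

theorem stmt4 {Y : Type*} [Fintype Y] [Nonempty Y] (W : ZMod 2 → Y → ℝ)
    (hW0 : ∀ x y, 0 ≤ W x y) (hW1 : ∀ x, ∑ y : Y, W x y = 1) :
    cutoffRate W ≤ capacity W := by
  have hZ : 0 ≤ bhattacharyya W := Finset.sum_nonneg fun _ _ => Real.sqrt_nonneg _
  have hS : 0 < (1 + bhattacharyya W) / 2 := by positivity
  have hlog : 0 < Real.log 2 := Real.log_pos one_lt_two
  have key := Finset.sum_le_sum fun y (_ : y ∈ Finset.univ) =>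
    half_mul_log_div_mean_add_ge (hW0 0 y) (hW0 1 y) hS
  have hC : capacity W * Real.log 2 = ∑ y : Y,
      (1 / 2 * W 0 y * Real.log (W 0 y / (1 / 2 * W 0 y + 1 / 2 * W 1 y)) +
        1 / 2 * W 1 y * Real.log (W 1 y / (1 / 2 * W 0 y + 1 / 2 * W 1 y))) := by
    rw [capacity, Finset.sum_mul]
    refine Finset.sum_congr rfl fun y _ => ?_
    rw [show (∑ x : ZMod 2, (1 / 2) * W x y *
        Real.logb 2 (W x y / ((1 / 2) * W 0 y + (1 / 2) * W 1 y))) = _ from Fin.sum_univ_two _]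
    change (1 / 2 * W 0 y * Real.logb 2 _ + 1 / 2 * W 1 y * Real.logb 2 _) * _ = _
    simp only [Real.logb]
    field_simp
    rfl
  have hq : ∑ y : Y, (W 0 y + W 1 y) / 2 = 1 := by
    rw [← Finset.sum_div, Finset.sum_add_distrib, hW1, hW1]
    norm_num
  have hs : ∑ y : Y, ((W 0 y + W 1 y) / 2 + √(W 0 y * W 1 y)) / 2 =
      (1 + bhattacharyya W) / 2 := by
    rw [← Finset.sum_div, Finset.sum_add_distrib, hq, bhattacharyya]
  rw [Finset.sum_add_distrib, ← hC, ← Finset.sum_mul, Finset.sum_sub_distrib, hq,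
    ← Finset.sum_div, hs, div_self hS.ne', Real.log_div (by positivity) two_ne_zero] at key
  rw [cutoffRate, Real.logb, ← mul_le_mul_iff_left₀ hlog, sub_mul, div_mul_cancel₀ _ hlog.ne']
  linarith
end

section
/- For every binary-input memoryless channel W with finite output alphabet, C(W) ≤ √(1 − Z(W)²). -/
open scoped BigOperators

/-- The binary entropy lies above its chord between `0` and `1 / 2`. -/
lemma two_mul_log_two_le_binEntropy {p : ℝ} (hp₀ : 0 ≤ p) (hp : p ≤ 1 / 2) :
    2 * p * Real.log 2 ≤ Real.binEntropy p := by
  have h := Real.strictConcave_binEntropy.concaveOn.2 (show (0 : ℝ) ∈ Set.Icc 0 1 by norm_num)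
    (show (2⁻¹ : ℝ) ∈ Set.Icc 0 1 by norm_num) (show 0 ≤ 1 - 2 * p by linarith)
    (show 0 ≤ 2 * p by linarith) (by ring)
  simp only [smul_eq_mul, Real.binEntropy_zero, Real.binEntropy_two_inv] at h
  rw [show (1 - 2 * p) * 0 + 2 * p * 2⁻¹ = p by ring] at h
  linarith

lemma mul_logb_div_average {a s : ℝ} (hs : 0 < s) :
    a * Real.logb 2 (a / (1 / 2 * s)) = a + a * Real.log (a / s) / Real.log 2 := by
  have hl : Real.log 2 ≠ 0 := (Real.log_pos one_lt_two).ne'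
  rcases eq_or_ne a 0 with rfl | ha
  · simp
  · rw [show a / (1 / 2 * s) = 2 * (a / s) by field_simp, Real.logb,
      Real.log_mul two_ne_zero (div_ne_zero ha hs.ne')]
    field_simp

/-- The contribution of a single output symbol to the symmetric capacity is at most its
contribution to the total variation distance. -/
lemma capacity_term_le {a b : ℝ} (ha : 0 ≤ a) (hb : 0 ≤ b) :
    1 / 2 * a * Real.logb 2 (a / (1 / 2 * a + 1 / 2 * b)) +
      1 / 2 * b * Real.logb 2 (b / (1 / 2 * a + 1 / 2 * b)) ≤ 1 / 2 * |a - b| := by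
  wlog hab : b ≤ a generalizing a b
  · have h := this hb ha (le_of_not_ge hab)
    rw [abs_sub_comm, add_comm (1 / 2 * b) (1 / 2 * a)] at h
    linarith
  rw [abs_of_nonneg (sub_nonneg.2 hab)]
  rcases (add_nonneg ha hb).eq_or_lt with hs | hs
  · obtain rfl : a = 0 := by linarith
    obtain rfl : b = 0 := by linarith
    simp
  have hl : 0 < Real.log 2 := Real.log_pos one_lt_two
  have hp : b / (a + b) ≤ 1 / 2 := by
    rw [div_le_iff₀ hs]
    linarith
  have h := mul_le_mul_of_nonneg_left
    (two_mul_log_two_le_binEntropy (div_nonneg hb hs.le) hp) hs.le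
  rw [Real.binEntropy, Real.log_inv, Real.log_inv,
    show 1 - b / (a + b) = a / (a + b) by field_simp; ring] at h
  have h' : a * Real.log (a / (a + b)) / Real.log 2 + b * Real.log (b / (a + b)) / Real.log 2
      ≤ -(2 * b) := by
    rw [← add_div, div_le_iff₀ hl]
    have e₁ : (a + b) * (2 * (b / (a + b)) * Real.log 2) = 2 * b * Real.log 2 := by
      field_simp
    have e₂ : (a + b) * (b / (a + b) * -Real.log (b / (a + b)) +
        a / (a + b) * -Real.log (a / (a + b))) =
        -(b * Real.log (b / (a + b))) - a * Real.log (a / (a + b)) := by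
      generalize Real.log (b / (a + b)) = u
      generalize Real.log (a / (a + b)) = v
      field_simp
      ring
    linarith
  rw [← mul_add, mul_assoc, mul_assoc, mul_logb_div_average hs, mul_logb_div_average hs]
  linarith

lemma capacity_le_totalVariation {Y : Type*} [Fintype Y] {W : ZMod 2 → Y → ℝ}
    (hW0 : ∀ x y, 0 ≤ W x y) : capacity W ≤ 1 / 2 * ∑ y, |W 0 y - W 1 y| := by
  rw [capacity, Finset.mul_sum]
  refine Finset.sum_le_sum fun y _ => ?_
  have h := Fin.sum_univ_two fun x : ZMod 2 =>
    (1 / 2) * W x y * Real.logb 2 (W x y / ((1 / 2) * W 0 y + (1 / 2) * W 1 y))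
  exact h.trans_le (capacity_term_le (hW0 0 y) (hW0 1 y))

lemma sq_totalVariation_le {Y : Type*} [Fintype Y] {W : ZMod 2 → Y → ℝ}
    (hW0 : ∀ x y, 0 ≤ W x y) (hW1 : ∀ x, ∑ y, W x y = 1) :
    (1 / 2 * ∑ y, |W 0 y - W 1 y|) ^ 2 ≤ 1 - bhattacharyya W ^ 2 := by
  have hsq (x y) : √(W x y) ^ 2 = W x y := Real.sq_sqrt (hW0 x y)
  have hmul (y) : √(W 0 y * W 1 y) = √(W 0 y) * √(W 1 y) := Real.sqrt_mul (hW0 0 y) _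
  have h := Finset.sum_mul_sq_le_sq_mul_sq Finset.univ
    (fun y => |√(W 0 y) - √(W 1 y)|) (fun y => √(W 0 y) + √(W 1 y))
  have e (y) : |√(W 0 y) - √(W 1 y)| * (√(W 0 y) + √(W 1 y)) = |W 0 y - W 1 y| := by
    rw [← abs_of_nonneg (add_nonneg (Real.sqrt_nonneg (W 0 y)) (Real.sqrt_nonneg (W 1 y))),
      ← abs_mul]
    congr 1
    linear_combination hsq 0 y - hsq 1 y
  have em : ∑ y, |√(W 0 y) - √(W 1 y)| ^ 2 = 2 - 2 * bhattacharyya W := by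
    have hy (y) : |√(W 0 y) - √(W 1 y)| ^ 2 = W 0 y + W 1 y - 2 * √(W 0 y * W 1 y) := by
      rw [sq_abs, hmul]
      linear_combination hsq 0 y + hsq 1 y
    simp only [hy, Finset.sum_sub_distrib, Finset.sum_add_distrib, hW1, ← Finset.mul_sum,
      bhattacharyya]
    norm_num
  have ep : ∑ y, (√(W 0 y) + √(W 1 y)) ^ 2 = 2 + 2 * bhattacharyya W := by
    have hy (y) : (√(W 0 y) + √(W 1 y)) ^ 2 = W 0 y + W 1 y + 2 * √(W 0 y * W 1 y) := by
      rw [hmul]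
      linear_combination hsq 0 y + hsq 1 y
    simp only [hy, Finset.sum_add_distrib, hW1, ← Finset.mul_sum, bhattacharyya]
    norm_num
  simp only [e] at h
  rw [em, ep] at h
  linarith

theorem stmt5 {Y : Type*} [Fintype Y] [Nonempty Y] (W : ZMod 2 → Y → ℝ)
    (hW0 : ∀ x y, 0 ≤ W x y) (hW1 : ∀ x, ∑ y : Y, W x y = 1) :
    capacity W ≤ Real.sqrt (1 - bhattacharyya W ^ 2) := by
  exact (capacity_le_totalVariation hW0).trans
    (Real.le_sqrt_of_sq_le (sq_totalVariation_le hW0 hW1))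
end

section
/- The symmetric capacity and symmetric cutoff rate polarize to the same extremal points, uniformly over all channels: for every η > 0 there exists δ > 0 such that for every finite output alphabet Y and every binary-input memoryless channel W on Y, (i) if C(W) > 1 − δ then R₀(W) > 1 − η, and (ii) if C(W) < δ then R₀(W) < η. -/
open scoped BigOperators

theorem two_mul_sub_sqrt_mul_le_mul_log {a q : ℝ} (ha : 0 ≤ a) (hq : 0 ≤ q) (h : q = 0 → a = 0) :
    2 * (a - √a * √q) ≤ a * Real.log (a / q) := by
  rcases ha.eq_or_lt with rfl | ha
  · simp
  have hq : 0 < q := hq.lt_of_ne fun h0 => ha.ne' (h h0.symm)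
  have hlog : Real.log √(q / a) ≤ √(q / a) - 1 :=
    Real.log_le_sub_one_of_pos (Real.sqrt_pos.2 (div_pos hq ha))
  rw [Real.log_sqrt (div_pos hq ha).le, Real.log_div hq.ne' ha.ne', Real.sqrt_div hq.le] at hlog
  have hmul : a * (√q / √a) = √a * √q := by
    have := Real.sqrt_pos.2 ha
    field_simp
    rw [Real.sq_sqrt ha.le]
  rw [Real.log_div ha.ne' hq.ne']
  nlinarith [mul_le_mul_of_nonneg_left hlog ha.le]

theorem mul_logb_le_sub_mul_div {a b : ℝ} (ha : 0 ≤ a) (hb : 0 ≤ b) :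
    a * Real.logb 2 (a / ((1 / 2) * a + (1 / 2) * b)) ≤ a - a * b / (a + b) := by
  rcases ha.eq_or_lt with rfl | ha
  · simp
  have hab : 0 < a + b := by linarith
  have hsplit : a / ((1 / 2) * a + (1 / 2) * b) = 2 * (a / (a + b)) := by
    field_simp
  have hlog : Real.log (a / (a + b)) ≤ -(b / (a + b)) := by
    refine (Real.log_le_sub_one_of_pos (div_pos ha hab)).trans_eq ?_
    field_simp
    ring
  have hfrac : 0 ≤ b / (a + b) := div_nonneg hb hab.le
  have hlogb : Real.logb 2 (a / (a + b)) ≤ -(b / (a + b)) := by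
    rw [Real.logb, div_le_iff₀ (Real.log_pos one_lt_two)]
    nlinarith [Real.log_two_lt_d9]
  rw [hsplit, Real.logb_mul two_ne_zero (div_pos ha hab).ne',
    Real.logb_self_eq_one one_lt_two, mul_div_assoc]
  nlinarith

theorem half_add_sub_sqrt_le_log {a b : ℝ} (ha : 0 ≤ a) (hb : 0 ≤ b) :
    (a + b) / 2 - √(a * b) ≤
      a * Real.log (a / ((1 / 2) * a + (1 / 2) * b)) +
        b * Real.log (b / ((1 / 2) * a + (1 / 2) * b)) := by
  have hq : 0 ≤ (1 / 2) * a + (1 / 2) * b := by positivity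
  have h₁ := two_mul_sub_sqrt_mul_le_mul_log ha hq (by intro; linarith)
  have h₂ := two_mul_sub_sqrt_mul_le_mul_log hb hq (by intro; linarith)
  rw [Real.sqrt_mul ha]
  nlinarith [Real.sq_sqrt ha, Real.sq_sqrt hb, Real.sq_sqrt hq,
    sq_nonneg (2 * √((1 / 2) * a + (1 / 2) * b) - (√a + √b))]

section Channel

variable {Y : Type*} [Fintype Y] {W : ZMod 2 → Y → ℝ}

theorem capacity_eq_sum (W : ZMod 2 → Y → ℝ) :
    capacity W = ∑ y, (1 / 2) *
      (W 0 y * Real.logb 2 (W 0 y / ((1 / 2) * W 0 y + (1 / 2) * W 1 y)) +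
        W 1 y * Real.logb 2 (W 1 y / ((1 / 2) * W 0 y + (1 / 2) * W 1 y))) := by
  have sum_inputs (f : ZMod 2 → ℝ) : ∑ x, f x = f 0 + f 1 := Fin.sum_univ_two f
  refine Finset.sum_congr rfl fun y _ => ?_
  rw [sum_inputs]
  ring

theorem bhattacharyya_nonneg (W : ZMod 2 → Y → ℝ) : 0 ≤ bhattacharyya W :=
  Finset.sum_nonneg fun _ _ => Real.sqrt_nonneg _

theorem one_sub_bhattacharyya_le (hW : ∀ x y, 0 ≤ W x y) (hsum : ∀ x, ∑ y, W x y = 1) :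
    1 - bhattacharyya W ≤ 2 * Real.log 2 * capacity W := by
  have hleft : 1 - bhattacharyya W = ∑ y, ((W 0 y + W 1 y) / 2 - √(W 0 y * W 1 y)) := by
    rw [Finset.sum_sub_distrib, ← Finset.sum_div, Finset.sum_add_distrib, hsum, hsum,
      bhattacharyya]
    norm_num
  rw [hleft, capacity_eq_sum, Finset.mul_sum]
  refine Finset.sum_le_sum fun y _ => (half_add_sub_sqrt_le_log (hW 0 y) (hW 1 y)).trans_eq ?_
  have := (Real.log_pos one_lt_two).ne'
  simp only [Real.logb]
  field_simp

theorem sq_bhattacharyya_le (hW : ∀ x y, 0 ≤ W x y) (hsum : ∀ x, ∑ y, W x y = 1) :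
    bhattacharyya W ^ 2 ≤ 2 * (1 - capacity W) := by
  have hnonneg (y : Y) : 0 ≤ W 0 y + W 1 y := add_nonneg (hW 0 y) (hW 1 y)
  have htotal : ∑ y, (W 0 y + W 1 y) = 2 := by
    rw [Finset.sum_add_distrib, hsum, hsum]
    norm_num
  have hcs : bhattacharyya W ^ 2 ≤
      (∑ y, W 0 y * W 1 y / (W 0 y + W 1 y)) * ∑ y, (W 0 y + W 1 y) := by
    refine Finset.sum_sq_le_sum_mul_sum_of_sq_le_mul _
      (fun y _ => div_nonneg (mul_nonneg (hW 0 y) (hW 1 y)) (hnonneg y))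
      (fun y _ => hnonneg y) fun y _ => le_of_eq ?_
    rw [Real.sq_sqrt (mul_nonneg (hW 0 y) (hW 1 y)), div_mul_cancel_of_imp]
    intro h
    rw [((add_eq_zero_iff_of_nonneg (hW 0 y) (hW 1 y)).1 h).1, zero_mul]
  have hcap : capacity W ≤
      ∑ y, ((W 0 y + W 1 y) / 2 - W 0 y * W 1 y / (W 0 y + W 1 y)) := by
    rw [capacity_eq_sum]
    refine Finset.sum_le_sum fun y _ => ?_
    have h₀ := mul_logb_le_sub_mul_div (hW 0 y) (hW 1 y)
    have h₁ := mul_logb_le_sub_mul_div (hW 1 y) (hW 0 y)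
    rw [add_comm ((1 / 2) * W 1 y), mul_comm (W 1 y) (W 0 y), add_comm (W 1 y) (W 0 y)] at h₁
    linarith
  rw [Finset.sum_sub_distrib, ← Finset.sum_div, htotal] at hcap
  rw [htotal] at hcs
  linarith

theorem bhattacharyya_le_one (hW : ∀ x y, 0 ≤ W x y) (hsum : ∀ x, ∑ y, W x y = 1) :
    bhattacharyya W ≤ 1 := by
  have h : bhattacharyya W ≤ ∑ y, (W 0 y + W 1 y) / 2 := by
    refine Finset.sum_le_sum fun y _ => ?_
    rw [Real.sqrt_mul (hW 0 y)]
    nlinarith [sq_nonneg (√(W 0 y) - √(W 1 y)), Real.sq_sqrt (hW 0 y), Real.sq_sqrt (hW 1 y)]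
  rw [← Finset.sum_div, Finset.sum_add_distrib, hsum, hsum] at h
  linarith

theorem one_sub_two_mul_bhattacharyya_le_cutoffRate (W : ZMod 2 → Y → ℝ) :
    1 - 2 * bhattacharyya W ≤ cutoffRate W := by
  have hZ := bhattacharyya_nonneg W
  have hlog := Real.log_le_sub_one_of_pos (show 0 < 1 + bhattacharyya W by linarith)
  have : Real.logb 2 (1 + bhattacharyya W) ≤ 2 * bhattacharyya W := by
    rw [Real.logb, div_le_iff₀ (Real.log_pos one_lt_two)]
    nlinarith [Real.log_two_gt_d9]
  rw [cutoffRate]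
  linarith

theorem cutoffRate_le_two_mul_capacity (hW : ∀ x y, 0 ≤ W x y) (hsum : ∀ x, ∑ y, W x y = 1) :
    cutoffRate W ≤ 2 * capacity W := by
  have hZ := bhattacharyya_nonneg W
  have hZ1 := bhattacharyya_le_one hW hsum
  have hpos : 0 < 1 + bhattacharyya W := by linarith
  have hlog2 := Real.log_pos one_lt_two
  have hlog := Real.log_le_sub_one_of_pos (div_pos two_pos hpos)
  rw [Real.log_div two_ne_zero hpos.ne'] at hlog
  have hfrac : 2 / (1 + bhattacharyya W) - 1 ≤ 1 - bhattacharyya W := by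
    rw [sub_le_iff_le_add, div_le_iff₀ hpos]
    nlinarith
  have hcap := one_sub_bhattacharyya_le hW hsum
  have hrate : cutoffRate W = (Real.log 2 - Real.log (1 + bhattacharyya W)) / Real.log 2 := by
    rw [cutoffRate, Real.logb, sub_div, div_self hlog2.ne']
  rw [hrate, div_le_iff₀ hlog2]
  linarith

end Channel

theorem stmt6 :
    ∀ η : ℝ, 0 < η → ∃ δ : ℝ, 0 < δ ∧
      ∀ (Y : Type) [Fintype Y] [Nonempty Y] (W : ZMod 2 → Y → ℝ),
        (∀ x y, 0 ≤ W x y) → (∀ x, ∑ y : Y, W x y = 1) →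
        (capacity W > 1 - δ → cutoffRate W > 1 - η) ∧
        (capacity W < δ → cutoffRate W < η) := by
  intro η hη
  refine ⟨min (η ^ 2 / 8) (η / 2), by positivity, fun Y _ _ W hW hsum =>
    ⟨fun hC => ?_, fun hC => ?_⟩⟩
  · have hsq := sq_bhattacharyya_le hW hsum
    have hmin := min_le_left (η ^ 2 / 8) (η / 2)
    have hZ : bhattacharyya W < η / 2 := by
      refine lt_of_pow_lt_pow_left₀ 2 (by positivity) ?_
      linarith [div_pow η 2 2]
    linarith [one_sub_two_mul_bhattacharyya_le_cutoffRate W]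
  · linarith [cutoffRate_le_two_mul_capacity hW hsum, min_le_right (η ^ 2 / 8) (η / 2)]
end

section
/- The one-step polar transform conserves symmetric capacity: for every binary-input memoryless channel W with finite output alphabet, C(W⁻) + C(W⁺) = 2·C(W). -/
open scoped BigOperators

/-- The minus channel `W⁻` of the one-step polar transform:
`W⁻ u₁ (y₁, y₂) = ∑_{u₂} (1/2)·W (u₁+u₂) y₁ · W u₂ y₂`. -/
noncomputable def Wminus {Y : Type*} (W : ZMod 2 → Y → ℝ) : ZMod 2 → Y × Y → ℝ :=
  fun u₁ y => ∑ u₂ : ZMod 2, (1 / 2) * W (u₁ + u₂) y.1 * W u₂ y.2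

/-- The plus channel `W⁺` of the one-step polar transform:
`W⁺ u₂ (y₁, y₂, u₁) = (1/2)·W (u₁+u₂) y₁ · W u₂ y₂`. -/
noncomputable def Wplus {Y : Type*} (W : ZMod 2 → Y → ℝ) : ZMod 2 → Y × Y × ZMod 2 → ℝ :=
  fun u₂ y => (1 / 2) * W (y.2.2 + u₂) y.1 * W u₂ y.2.1

/-- The function `x ↦ x log₂ x`. -/
noncomputable def mulLogb (x : ℝ) : ℝ := x * Real.logb 2 x

theorem mulLogb_mul (x y : ℝ) : mulLogb (x * y) = y * mulLogb x + x * mulLogb y := by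
  unfold mulLogb
  rcases eq_or_ne x 0 with rfl | hx
  · simp
  rcases eq_or_ne y 0 with rfl | hy
  · simp
  rw [Real.logb_mul hx hy]
  ring

theorem mulLogb_half_mul (x : ℝ) : mulLogb (1 / 2 * x) = 1 / 2 * mulLogb x - 1 / 2 * x := by
  have h : mulLogb (1 / 2) = -(1 / 2) := by simp [mulLogb]
  rw [mulLogb_mul, h]
  ring

theorem mul_logb_div {p q : ℝ} (h : q = 0 → p = 0) :
    p * Real.logb 2 (p / q) = mulLogb p - p * Real.logb 2 q := by
  rcases eq_or_ne p 0 with rfl | hp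
  · simp [mulLogb]
  rw [Real.logb_div hp (mt h hp), mulLogb]
  ring

theorem sum_zmod_two (f : ZMod 2 → ℝ) : ∑ x, f x = f 0 + f 1 :=
  Fin.sum_univ_two f

/-- The contribution to the symmetric capacity of an output symbol with likelihoods `a` and `b`. -/
noncomputable def symbolInfo (a b : ℝ) : ℝ :=
  1 / 2 * mulLogb a + 1 / 2 * mulLogb b - mulLogb (1 / 2 * a + 1 / 2 * b)

theorem capacity_eq_sum_symbolInfo {Y : Type*} [Fintype Y] (W : ZMod 2 → Y → ℝ)
    (hW : ∀ x y, 0 ≤ W x y) : capacity W = ∑ y, symbolInfo (W 0 y) (W 1 y) := by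
  refine Finset.sum_congr rfl fun y _ => ?_
  have h0 := hW 0 y
  have h1 := hW 1 y
  rw [sum_zmod_two, mul_assoc, mul_assoc, mul_logb_div fun h => by linarith,
    mul_logb_div fun h => by linarith, symbolInfo, mulLogb.eq_1 (_ + _)]
  ring

/-- The polar transform preserves information for each pair of output symbols. -/
theorem symbolInfo_polar (a₀ a₁ b₀ b₁ : ℝ) :
    symbolInfo (1 / 2 * a₀ * b₀ + 1 / 2 * a₁ * b₁) (1 / 2 * a₁ * b₀ + 1 / 2 * a₀ * b₁) +
      (symbolInfo (1 / 2 * a₀ * b₀) (1 / 2 * a₁ * b₁) +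
        symbolInfo (1 / 2 * a₁ * b₀) (1 / 2 * a₀ * b₁)) =
      symbolInfo a₀ a₁ * (1 / 2 * b₀ + 1 / 2 * b₁) +
        (1 / 2 * a₀ + 1 / 2 * a₁) * symbolInfo b₀ b₁ := by
  have hs : 1 / 2 * (1 / 2 * a₀ * b₀ + 1 / 2 * a₁ * b₁) +
      1 / 2 * (1 / 2 * a₁ * b₀ + 1 / 2 * a₀ * b₁) =
      (1 / 2 * a₀ + 1 / 2 * a₁) * (1 / 2 * b₀ + 1 / 2 * b₁) := by ring
  simp only [symbolInfo]
  rw [hs, ← mul_add (1 / 2) (1 / 2 * a₀ * b₀), ← mul_add (1 / 2) (1 / 2 * a₁ * b₀),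
    mulLogb_half_mul (1 / 2 * a₀ * b₀ + _), mulLogb_half_mul (1 / 2 * a₁ * b₀ + _),
    mulLogb_mul (_ + _) (_ + _)]
  simp only [mulLogb_mul (1 / 2 * _), mulLogb_half_mul a₀, mulLogb_half_mul a₁]
  ring

theorem stmt7 {Y : Type*} [Fintype Y] [Nonempty Y] (W : ZMod 2 → Y → ℝ)
    (hW0 : ∀ x y, 0 ≤ W x y) (hW1 : ∀ x, ∑ y : Y, W x y = 1) :
    capacity (Wminus W) + capacity (Wplus W) = 2 * capacity W := by
  have hm : ∀ x y, 0 ≤ Wminus W x y := fun x y =>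
    Finset.sum_nonneg fun u _ =>
      mul_nonneg (mul_nonneg (by norm_num) (hW0 _ _)) (hW0 _ _)
  have hp : ∀ x y, 0 ≤ Wplus W x y := fun x y =>
    mul_nonneg (mul_nonneg (by norm_num) (hW0 _ _)) (hW0 _ _)
  have hone : (1 + 1 : ZMod 2) = 0 := rfl
  have hsum : ∑ y, (1 / 2 * W 0 y + 1 / 2 * W 1 y) = 1 := by
    rw [Finset.sum_add_distrib, ← Finset.mul_sum, ← Finset.mul_sum, hW1, hW1]
    norm_num
  rw [capacity_eq_sum_symbolInfo _ hm, capacity_eq_sum_symbolInfo _ hp,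
    capacity_eq_sum_symbolInfo _ hW0]
  simp only [Fintype.sum_prod_type, ← Finset.sum_add_distrib, sum_zmod_two, Wminus, Wplus,
    zero_add, add_zero, hone, symbolInfo_polar]
  simp_rw [Finset.sum_add_distrib (f := fun _ => _ * _), ← Finset.mul_sum, hsum, mul_one]
  rw [Finset.sum_add_distrib, ← Finset.sum_mul, hsum]
  ring
end

section
/- For every binary-input memoryless channel W with finite output alphabet, the Bhattacharyya parameter of the plus channel satisfies Z(W⁺) = Z(W)². -/
open scoped BigOperators

/-- For each value of the side information `u`, a summand of the Bhattacharyya parameter of the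
plus channel factors into the summands of the original channel. -/
theorem sqrt_Wplus_mul {Y : Type*} {W : ZMod 2 → Y → ℝ} (hW0 : ∀ x y, 0 ≤ W x y)
    (y₁ y₂ : Y) (u : ZMod 2) :
    Real.sqrt (Wplus W 0 (y₁, y₂, u) * Wplus W 1 (y₁, y₂, u)) =
      (1 / 2) * (Real.sqrt (W 0 y₁ * W 1 y₁) * Real.sqrt (W 0 y₂ * W 1 y₂)) := by
  have h : W (u + 0) y₁ * W (u + 1) y₁ = W 0 y₁ * W 1 y₁ := by
    obtain rfl | rfl : u = 0 ∨ u = 1 := by decide +revert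
    · simp
    · have h11 : (1 : ZMod 2) + 1 = 0 := by decide
      rw [add_zero, h11, mul_comm]
  have hprod : Wplus W 0 (y₁, y₂, u) * Wplus W 1 (y₁, y₂, u) =
      (1 / 2) ^ 2 * (W 0 y₁ * W 1 y₁ * (W 0 y₂ * W 1 y₂)) := by
    rw [← h]
    simp only [Wplus]
    ring
  rw [hprod, Real.sqrt_mul (by positivity), Real.sqrt_sq (by norm_num),
    Real.sqrt_mul (mul_nonneg (hW0 0 y₁) (hW0 1 y₁))]

theorem stmt8 {Y : Type*} [Fintype Y] [Nonempty Y] (W : ZMod 2 → Y → ℝ)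
    (hW0 : ∀ x y, 0 ≤ W x y) (hW1 : ∀ x, ∑ y : Y, W x y = 1) :
    bhattacharyya (Wplus W) = bhattacharyya W ^ 2 := by
  simp only [bhattacharyya, Fintype.sum_prod_type, sqrt_Wplus_mul hW0, Finset.sum_const,
    Finset.card_univ, ZMod.card, nsmul_eq_mul, sq, Finset.sum_mul_sum]
  refine Finset.sum_congr rfl fun y₁ _ => Finset.sum_congr rfl fun y₂ _ => ?_
  push_cast
  ring
end

section
/- For every binary-input memoryless channel W with finite output alphabet, the Bhattacharyya parameter of the minus channel satisfies Z(W) ≤ Z(W⁻) ≤ 2·Z(W) − Z(W)². -/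
open scoped BigOperators

theorem sqrt_mul_add_le_sqrt_minus {a b c d : ℝ} (ha : 0 ≤ a) (hb : 0 ≤ b) (hc : 0 ≤ c)
    (hd : 0 ≤ d) :
    √(a * b) * (1 / 2 * (c + d)) ≤
      √((1 / 2 * a * c + 1 / 2 * b * d) * (1 / 2 * b * c + 1 / 2 * a * d)) := by
  apply Real.le_sqrt_of_sq_le
  rw [mul_pow, Real.sq_sqrt (mul_nonneg ha hb)]
  nlinarith [mul_nonneg (mul_nonneg hc hd) (sq_nonneg (a - b))]

theorem sqrt_minus_le {a b c d : ℝ} (ha : 0 ≤ a) (hb : 0 ≤ b) (hc : 0 ≤ c) (hd : 0 ≤ d) :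
    √((1 / 2 * a * c + 1 / 2 * b * d) * (1 / 2 * b * c + 1 / 2 * a * d)) ≤
      √(a * b) * (1 / 2 * (c + d)) + 1 / 2 * (a + b) * √(c * d) - √(a * b) * √(c * d) := by
  obtain ⟨p, hp, rfl⟩ : ∃ p, 0 ≤ p ∧ a = p ^ 2 := ⟨√a, Real.sqrt_nonneg a, (Real.sq_sqrt ha).symm⟩
  obtain ⟨q, hq, rfl⟩ : ∃ q, 0 ≤ q ∧ b = q ^ 2 := ⟨√b, Real.sqrt_nonneg b, (Real.sq_sqrt hb).symm⟩
  obtain ⟨r, hr, rfl⟩ : ∃ r, 0 ≤ r ∧ c = r ^ 2 := ⟨√c, Real.sqrt_nonneg c, (Real.sq_sqrt hc).symm⟩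
  obtain ⟨s, hs, rfl⟩ : ∃ s, 0 ≤ s ∧ d = s ^ 2 := ⟨√d, Real.sqrt_nonneg d, (Real.sq_sqrt hd).symm⟩
  rw [← mul_pow, ← mul_pow, Real.sqrt_sq (mul_nonneg hp hq), Real.sqrt_sq (mul_nonneg hr hs)]
  apply Real.sqrt_le_iff.mpr
  constructor
  · have h₁ := mul_nonneg (mul_nonneg hp hq) (sq_nonneg (r - s))
    have h₂ := mul_nonneg (mul_nonneg hr hs) (add_nonneg (sq_nonneg p) (sq_nonneg q))
    linarith
  · have h := mul_nonneg (mul_nonneg (mul_nonneg hp hq) (mul_nonneg hr hs))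
      (sq_nonneg ((p - q) * (r - s)))
    linarith

theorem bhattacharyya_Wminus {Y : Type*} [Fintype Y] (W : ZMod 2 → Y → ℝ) :
    bhattacharyya (Wminus W) = ∑ x : Y, ∑ y : Y,
      √((1 / 2 * W 0 x * W 0 y + 1 / 2 * W 1 x * W 1 y) *
        (1 / 2 * W 1 x * W 0 y + 1 / 2 * W 0 x * W 1 y)) := by
  have sum_two (f : ZMod 2 → ℝ) : ∑ u, f u = f 0 + f 1 := Fin.sum_univ_two f
  have h : (1 + 1 : ZMod 2) = 0 := rfl
  simp only [bhattacharyya, Wminus, Fintype.sum_prod_type, sum_two, h, zero_add, add_zero]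

theorem stmt9 {Y : Type*} [Fintype Y] [Nonempty Y] (W : ZMod 2 → Y → ℝ)
    (hW0 : ∀ x y, 0 ≤ W x y) (hW1 : ∀ x, ∑ y : Y, W x y = 1) :
    bhattacharyya W ≤ bhattacharyya (Wminus W) ∧
    bhattacharyya (Wminus W) ≤ 2 * bhattacharyya W - bhattacharyya W ^ 2 := by
  have hsum : ∑ y, 1 / 2 * (W 0 y + W 1 y) = 1 := by
    rw [← Finset.mul_sum, Finset.sum_add_distrib, hW1, hW1]
    norm_num
  rw [bhattacharyya_Wminus]
  constructor
  · calc bhattacharyya W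
        = ∑ x, ∑ y, √(W 0 x * W 1 x) * (1 / 2 * (W 0 y + W 1 y)) := by
          rw [← Finset.sum_mul_sum, hsum, mul_one, bhattacharyya]
      _ ≤ _ := Finset.sum_le_sum fun x _ => Finset.sum_le_sum fun y _ =>
          sqrt_mul_add_le_sqrt_minus (hW0 0 x) (hW0 1 x) (hW0 0 y) (hW0 1 y)
  · refine (Finset.sum_le_sum fun x _ => Finset.sum_le_sum fun y _ =>
      sqrt_minus_le (hW0 0 x) (hW0 1 x) (hW0 0 y) (hW0 1 y)).trans_eq ?_
    simp only [Finset.sum_sub_distrib, Finset.sum_add_distrib, ← Finset.sum_mul_sum, hsum,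
      bhattacharyya]
    ring
end

section
/- For the binary erasure channel BEC(ε) with 0 ≤ ε ≤ 1, the one-step polar transform yields Z(BEC(ε)⁻) = 2ε − ε² and Z(BEC(ε)⁺) = ε²; in particular the upper bound Z(W⁻) ≤ 2·Z(W) − Z(W)² holds with equality for the BEC. -/
open scoped BigOperators

/-- The binary erasure channel with erasure probability `ε`. -/
def BEC (ε : ℝ) : ZMod 2 → Option (ZMod 2) → ℝ := fun x y =>
  match y with
  | some y' => if y' = x then 1 - ε else 0
  | none => ε

theorem ZMod.sum_two {M : Type*} [AddCommMonoid M] (f : ZMod 2 → M) : ∑ x, f x = f 0 + f 1 :=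
  Fin.sum_univ_two f

theorem bhattacharyya_BEC {ε : ℝ} (hε0 : 0 ≤ ε) : bhattacharyya (BEC ε) = ε := by
  simp [bhattacharyya, BEC, Fintype.sum_option, ZMod.sum_two, Real.sqrt_mul_self hε0]

theorem bhattacharyya_Wminus_BEC {ε : ℝ} (hε0 : 0 ≤ ε) (hε1 : ε ≤ 1) :
    bhattacharyya (Wminus (BEC ε)) = 2 * ε - ε ^ 2 := by
  have h1 : 0 ≤ 1 - ε := sub_nonneg.2 hε1
  have h11 : (1 : ZMod 2) + 1 = 0 := rfl
  simp [bhattacharyya, Wminus, BEC, Fintype.sum_option, Fintype.sum_prod_type, ZMod.sum_two, h11]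
  ring_nf
  rw [show ε ^ 4 = (ε ^ 2) ^ 2 by ring,
    show ε ^ 2 * (1 / 4) + ε ^ 3 * (-1 / 2) + (ε ^ 2) ^ 2 * (1 / 4) = (ε * (1 - ε) / 2) ^ 2 by ring,
    Real.sqrt_sq (by positivity), Real.sqrt_sq (by positivity)]
  ring

theorem bhattacharyya_Wplus_BEC (ε : ℝ) :
    bhattacharyya (Wplus (BEC ε)) = ε ^ 2 := by
  have h11 : (1 : ZMod 2) + 1 = 0 := rfl
  simp [bhattacharyya, Wplus, BEC, Fintype.sum_option, Fintype.sum_prod_type, ZMod.sum_two, h11]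
  ring_nf
  rw [show ε ^ 4 * (1 / 4) = (ε ^ 2 / 2) ^ 2 by ring, Real.sqrt_sq (by positivity)]
  ring

theorem stmt11 (ε : ℝ) (hε0 : 0 ≤ ε) (hε1 : ε ≤ 1) :
    bhattacharyya (Wminus (BEC ε)) = 2 * ε - ε ^ 2 ∧
    bhattacharyya (Wplus (BEC ε)) = ε ^ 2 ∧
    bhattacharyya (Wminus (BEC ε)) =
      2 * bhattacharyya (BEC ε) - bhattacharyya (BEC ε) ^ 2 := by
  have hm := bhattacharyya_Wminus_BEC hε0 hε1
  exact ⟨hm, bhattacharyya_Wplus_BEC ε, by rw [hm, bhattacharyya_BEC hε0]⟩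
end

section
/- Channel polarization for the binary erasure channel: let g₀(x) = 2x − x² and g₁(x) = x², and for b ∈ {0,1}ⁿ let Z_b(ε) = (g_{bₙ} ∘ ⋯ ∘ g_{b₁})(ε). Then for every ε ∈ (0,1) and every δ ∈ (0,1), as n → ∞ the fraction (1/2ⁿ) · |{ b ∈ {0,1}ⁿ : Z_b(ε) < δ }| tends to 1 − ε, and the fraction (1/2ⁿ) · |{ b ∈ {0,1}ⁿ : Z_b(ε) > 1 − δ }| tends to ε. -/
open scoped BigOperators Classical

/-- One polarization step for the erasure probability of a BEC:
`g false = g₀ : x ↦ 2x − x²` (minus transform),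
`g true = g₁ : x ↦ x²` (plus transform). -/
noncomputable def g (b : Bool) (x : ℝ) : ℝ := if b then x ^ 2 else 2 * x - x ^ 2

/-- `Zb n b ε = (g_{bₙ} ∘ ⋯ ∘ g_{b₁}) ε`: the Bhattacharyya parameter of the
bit-channel indexed by the bit string `b` after `n` polarization steps
applied to `BEC(ε)`. -/
noncomputable def Zb : (n : ℕ) → (Fin n → Bool) → ℝ → ℝ
  | 0, _, ε => ε
  | n + 1, b, ε => g (b (Fin.last n)) (Zb n (fun i => b i.castSucc) ε)

theorem g_mem_Icc (c : Bool) {x : ℝ} (hx : x ∈ Set.Icc (0 : ℝ) 1) : g c x ∈ Set.Icc (0 : ℝ) 1 := by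
  obtain ⟨h0, h1⟩ := hx
  cases c <;> constructor <;> simp only [g, if_true, Bool.false_eq_true, if_false] <;> nlinarith

theorem Zb_mem_Icc {ε : ℝ} (hε : ε ∈ Set.Icc (0 : ℝ) 1) :
    ∀ (n : ℕ) (b : Fin n → Bool), Zb n b ε ∈ Set.Icc (0 : ℝ) 1
  | 0, _ => hε
  | n + 1, _ => g_mem_Icc _ (Zb_mem_Icc hε n _)

/-- The average of `f` over the Bhattacharyya parameters of the `2 ^ n` bit-channels. -/
noncomputable def bitChannelMean (ε : ℝ) (f : ℝ → ℝ) (n : ℕ) : ℝ :=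
  (∑ b : Fin n → Bool, f (Zb n b ε)) / 2 ^ n

theorem bitChannelMean_zero (ε : ℝ) (f : ℝ → ℝ) : bitChannelMean ε f 0 = f ε := by
  simp [bitChannelMean, Zb]

theorem bitChannelMean_succ (ε : ℝ) (f : ℝ → ℝ) (n : ℕ) :
    bitChannelMean ε f (n + 1) =
      bitChannelMean ε (fun x => (f (x ^ 2) + f (2 * x - x ^ 2)) / 2) n := by
  have h : ∑ b : Fin (n + 1) → Bool, f (Zb (n + 1) b ε) =
      ∑ b : Fin n → Bool, (f (Zb n b ε ^ 2) + f (2 * Zb n b ε - Zb n b ε ^ 2)) := by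
    rw [← (Fin.snocEquiv fun _ => Bool).sum_comp, Fintype.sum_prod_type, Fintype.sum_bool,
      ← Finset.sum_add_distrib]
    simp [Fin.snocEquiv, Zb, g]
  simp only [bitChannelMean]
  rw [h, ← Finset.sum_div, pow_succ]
  field_simp

theorem bitChannelMean_id (ε : ℝ) (n : ℕ) : bitChannelMean ε (fun x => x) n = ε := by
  induction n with
  | zero => exact bitChannelMean_zero ..
  | succ n ih =>
    rw [bitChannelMean_succ, ← ih]
    congr 1
    ext x
    ring

theorem bitChannelMean_const (ε c : ℝ) (n : ℕ) : bitChannelMean ε (fun _ => c) n = c := by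
  simp [bitChannelMean]

theorem bitChannelMean_add (ε : ℝ) (f h : ℝ → ℝ) (n : ℕ) :
    bitChannelMean ε (fun x => f x + h x) n = bitChannelMean ε f n + bitChannelMean ε h n := by
  simp only [bitChannelMean, Finset.sum_add_distrib, add_div]

theorem bitChannelMean_sub (ε : ℝ) (f h : ℝ → ℝ) (n : ℕ) :
    bitChannelMean ε (fun x => f x - h x) n = bitChannelMean ε f n - bitChannelMean ε h n := by
  simp only [bitChannelMean, Finset.sum_sub_distrib, sub_div]

theorem bitChannelMean_const_mul (ε K : ℝ) (f : ℝ → ℝ) (n : ℕ) :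
    bitChannelMean ε (fun x => K * f x) n = K * bitChannelMean ε f n := by
  simp only [bitChannelMean, ← Finset.mul_sum, mul_div_assoc]

theorem bitChannelMean_mono {ε : ℝ} (hε : ε ∈ Set.Icc (0 : ℝ) 1) {f h : ℝ → ℝ}
    (hfh : ∀ x ∈ Set.Icc (0 : ℝ) 1, f x ≤ h x) (n : ℕ) :
    bitChannelMean ε f n ≤ bitChannelMean ε h n := by
  unfold bitChannelMean
  gcongr with b
  exact hfh _ (Zb_mem_Icc hε n b)

theorem bitChannelMean_sq_le (ε : ℝ) (f : ℝ → ℝ) (n : ℕ) :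
    bitChannelMean ε f n ^ 2 ≤ bitChannelMean ε (fun x => f x ^ 2) n := by
  have h := sq_sum_le_card_mul_sum_sq (s := (Finset.univ : Finset (Fin n → Bool)))
    (f := fun b => f (Zb n b ε))
  simp only [Finset.card_univ, Fintype.card_fun, Fintype.card_bool, Fintype.card_fin] at h
  push_cast at h
  unfold bitChannelMean
  rw [div_pow, div_le_div_iff₀ (by positivity) (by positivity)]
  calc _ ≤ (2 ^ n * ∑ b : Fin n → Bool, f (Zb n b ε) ^ 2) * 2 ^ n := by gcongr
    _ = _ := by ring

/-- The second moment grows by the mean of `(x * (1 - x)) ^ 2` at each step. -/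
theorem bitChannelMean_sq_succ (ε : ℝ) (n : ℕ) :
    bitChannelMean ε (fun x => x ^ 2) (n + 1) =
      bitChannelMean ε (fun x => x ^ 2) n + bitChannelMean ε (fun x => (x * (1 - x)) ^ 2) n := by
  rw [bitChannelMean_succ, ← bitChannelMean_add]
  congr 1
  ext x
  ring

theorem tendsto_bitChannelMean_mul_one_sub_sq {ε : ℝ} (hε : ε ∈ Set.Icc (0 : ℝ) 1) :
    Filter.Tendsto (bitChannelMean ε fun x => (x * (1 - x)) ^ 2) Filter.atTop (nhds 0) := by
  have hnonneg (n : ℕ) : 0 ≤ bitChannelMean ε (fun x => (x * (1 - x)) ^ 2) n :=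
    (bitChannelMean_const ε 0 n).symm.trans_le
      (bitChannelMean_mono hε (fun x _ => sq_nonneg (x * (1 - x))) n)
  have hmono : Monotone (bitChannelMean ε fun x => x ^ 2) :=
    monotone_nat_of_le_succ fun n => by linarith [bitChannelMean_sq_succ ε n, hnonneg n]
  have hbdd : BddAbove (Set.range (bitChannelMean ε fun x => x ^ 2)) := by
    refine ⟨1, ?_⟩
    rintro _ ⟨n, rfl⟩
    exact (bitChannelMean_mono hε (fun x hx => pow_le_one₀ hx.1 hx.2) n).trans_eq
      (bitChannelMean_const ε 1 n)
  have hlim := tendsto_atTop_ciSup hmono hbdd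
  have hdiff := (hlim.comp (Filter.tendsto_add_atTop_nat 1)).sub hlim
  rw [sub_self] at hdiff
  refine hdiff.congr fun n => ?_
  simp [bitChannelMean_sq_succ]

theorem tendsto_card_filter_Zb {ε : ℝ} (hε : ε ∈ Set.Icc (0 : ℝ) 1) (p : ℝ → Prop)
    [DecidablePred p] {h : ℝ → ℝ} {c K : ℝ} (hc : ∀ n, bitChannelMean ε h n = c)
    (hK : ∀ x ∈ Set.Icc (0 : ℝ) 1, ((if p x then 1 else 0) - h x) ^ 2 ≤ K * (x * (1 - x)) ^ 2) :
    Filter.Tendsto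
      (fun n : ℕ =>
        ((Finset.univ.filter (fun b : Fin n → Bool => p (Zb n b ε))).card : ℝ) / 2 ^ n)
      Filter.atTop (nhds c) := by
  have hcard (n : ℕ) :
      ((Finset.univ.filter (fun b : Fin n → Bool => p (Zb n b ε))).card : ℝ) / 2 ^ n =
        bitChannelMean ε (fun x => if p x then 1 else 0) n := by
    simp [bitChannelMean]
  simp only [hcard]
  have hbound (n : ℕ) : (bitChannelMean ε (fun x => if p x then 1 else 0) n - c) ^ 2 ≤
      K * bitChannelMean ε (fun x => (x * (1 - x)) ^ 2) n := by
    rw [← hc n, ← bitChannelMean_sub, ← bitChannelMean_const_mul]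
    exact (bitChannelMean_sq_le ..).trans (bitChannelMean_mono hε hK n)
  have hlim := (tendsto_bitChannelMean_mul_one_sub_sq hε).const_mul K
  rw [mul_zero] at hlim
  have hsq := squeeze_zero (fun n => sq_nonneg _) hbound hlim
  have habs := hsq.sqrt
  simp only [Real.sqrt_sq_eq_abs, Real.sqrt_zero] at habs
  exact tendsto_sub_nhds_zero_iff.1 ((tendsto_zero_iff_abs_tendsto_zero _).2 habs)

theorem sq_le_one_div_sq_mul_sq {a u v : ℝ} (ha : 0 < a) (hav : a ≤ v) :
    u ^ 2 ≤ 1 / a ^ 2 * (u * v) ^ 2 := by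
  rw [one_div_mul_eq_div, le_div_iff₀ (by positivity), mul_pow]
  gcongr

theorem stmt13 (ε : ℝ) (hε : ε ∈ Set.Ioo (0 : ℝ) 1) (δ : ℝ) (hδ : δ ∈ Set.Ioo (0 : ℝ) 1) :
    Filter.Tendsto
      (fun n : ℕ =>
        ((Finset.univ.filter (fun b : Fin n → Bool => Zb n b ε < δ)).card : ℝ) / 2 ^ n)
      Filter.atTop (nhds (1 - ε)) ∧
    Filter.Tendsto
      (fun n : ℕ =>
        ((Finset.univ.filter (fun b : Fin n → Bool => Zb n b ε > 1 - δ)).card : ℝ) / 2 ^ n)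
      Filter.atTop (nhds ε) := by
  have hε' : ε ∈ Set.Icc (0 : ℝ) 1 := Set.Ioo_subset_Icc_self hε
  obtain ⟨hδ0, hδ1⟩ := hδ
  have hpos : 0 < δ * (1 - δ) := mul_pos hδ0 (sub_pos.2 hδ1)
  refine ⟨tendsto_card_filter_Zb hε' (· < δ) (h := fun x => 1 - x)
    (K := 1 / (δ * (1 - δ)) ^ 2) (fun n => ?_) fun x _ => ?_,
    tendsto_card_filter_Zb hε' (· > 1 - δ) (h := fun x => x)
    (K := 1 / (δ * (1 - δ)) ^ 2) (bitChannelMean_id ε) fun x _ => ?_⟩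
  · rw [bitChannelMean_sub, bitChannelMean_const, bitChannelMean_id]
  · split_ifs with hx
    · have := sq_le_one_div_sq_mul_sq (u := x) (v := 1 - x) hpos (by nlinarith)
      simpa using this
    · have := sq_le_one_div_sq_mul_sq (u := 1 - x) (v := x) hpos (by nlinarith)
      rwa [zero_sub, neg_sq, mul_comm x]
  · split_ifs with hx
    · have := sq_le_one_div_sq_mul_sq (u := 1 - x) (v := x) hpos (by nlinarith)
      rwa [mul_comm x]
    · have := sq_le_one_div_sq_mul_sq (u := x) (v := 1 - x) hpos (by nlinarith)
      rwa [zero_sub, neg_sq]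
end
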